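/- Let E be a real normed space, f : E → ℝ Fréchet differentiable, and μ : [0, ∞) → ℝ nonnegative with the upper curvature property for f, satisfying the growth condition μ(β t) ≥ β² μ(t) for all t ≥ 0 and β ∈ [0,1], and such that τ ↦ μ(τ)/τ is integrable on (0, r] for every r > 0. Define σ(r) = ∫₀^r μ(τ)/τ dτ. Let ε > 0 and r > 0 satisfy σ(r) = ε/2, and let M ≥ 2ε/r². Then for all x, y ∈ E, |f(y) − f(x) − ⟨f'(x), y − x⟩| ≤ (1/2) M ‖y − x‖² + ε/2. -/

import Mathlib

/-- The upper curvature property bounds the linearization error of a differentiable function. -/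
theorem abs_sub_sub_fderiv_le_of_curvature {E : Type*} [NormedAddCommGroup E] [NormedSpace ℝ E]
    {f : E → ℝ} {L : E →L[ℝ] ℝ} {x y : E} {c : ℝ} (hf : HasFDerivAt f L x) (hc : 0 ≤ c)
    (hcurv : ∀ α ∈ Set.Ioo (0:ℝ) 1,
      |α * f y + (1 - α) * f x - f (α • y + (1 - α) • x)| ≤ α * (1 - α) * c) :
    |f y - f x - L (y - x)| ≤ c := by
  have hd : HasLineDerivAt ℝ f (L (y - x)) x (y - x) := hf.hasLineDerivAt _
  have hlim := hd.tendsto_slope_zero_right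
  refine le_of_tendsto ((tendsto_const_nhds.sub hlim).abs) ?_
  filter_upwards [Ioo_mem_nhdsGT (zero_lt_one (α := ℝ))] with α hα
  have h := hcurv α hα
  have hpos : 0 < α := hα.1
  rw [show α • y + (1 - α) • x = x + α • (y - x) by module] at h
  have hscale : α * f y + (1 - α) * f x - f (x + α • (y - x))
      = α * (f y - f x - α⁻¹ • (f (x + α • (y - x)) - f x)) := by
    simp only [smul_eq_mul]
    field_simp
    ring
  rw [hscale, abs_mul, abs_of_pos hpos, mul_assoc] at h
  have h' := le_of_mul_le_mul_left h hpos
  nlinarith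

/-- The linearization error at distance `t` is controlled by the curvature modulus at any larger
distance `s`, with the factor `2 * (t / s)`. -/
theorem mul_abs_sub_sub_fderiv_le_of_curvature {E : Type*} [NormedAddCommGroup E]
    [NormedSpace ℝ E] {f : E → ℝ} {L : E →L[ℝ] ℝ} {μ : ℝ → ℝ} {x y : E} {s : ℝ}
    (hf : HasFDerivAt f L x) (hμ0 : 0 ≤ μ s)
    (hcurv : ∀ x y : E, ∀ α ∈ Set.Ioo (0:ℝ) 1,
      |α * f x + (1 - α) * f y - f (α • x + (1 - α) • y)| ≤ α * (1 - α) * μ ‖x - y‖)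
    (hxy : 0 < ‖y - x‖) (hs : ‖y - x‖ < s) :
    s * |f y - f x - L (y - x)| ≤ 2 * ‖y - x‖ * μ s := by
  set t := ‖y - x‖ with ht
  have hs0 : 0 < s := hxy.trans hs
  set z := x + (s / t) • (y - x) with hz
  have hzx : z - x = (s / t) • (y - x) := by rw [hz]; abel
  have hnorm : ‖z - x‖ = s := by
    rw [hzx, norm_smul, Real.norm_of_nonneg (by positivity), ← ht]
    field_simp
  have hα : t / s ∈ Set.Ioo (0:ℝ) 1 := ⟨by positivity, (div_lt_one hs0).2 hs⟩
  have h₁ := hcurv z x (t / s) hα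
  have h₂ := abs_sub_sub_fderiv_le_of_curvature hf (hnorm.symm ▸ hμ0) (hcurv z x)
  have hy : (t / s) • z + (1 - t / s) • x = y := by
    have : (t / s) • z + (1 - t / s) • x = x + (t / s) • (z - x) := by module
    rw [this, hzx, smul_smul, show t / s * (s / t) = 1 by field_simp, one_smul]
    abel
  have hL : L (y - x) = t / s * L (z - x) := by
    rw [hzx, map_smul, smul_eq_mul]
    field_simp
  rw [hy, hnorm] at h₁
  rw [hnorm] at h₂
  set a := t / s with ha
  have hkey : |f y - f x - L (y - x)| ≤ 2 * a * μ s := by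
    have ha0 := hα.1
    have hsq := mul_nonneg (mul_nonneg ha0.le ha0.le) hμ0
    rw [hL]
    rw [abs_le] at h₁ h₂ ⊢
    have hl := mul_le_mul_of_nonneg_left h₂.1 ha0.le
    have hu := mul_le_mul_of_nonneg_left h₂.2 ha0.le
    constructor <;> nlinarith [h₁.1, h₁.2]
  calc s * |f y - f x - L (y - x)| ≤ s * (2 * a * μ s) := by gcongr
    _ = 2 * t * μ s := by rw [ha]; field_simp

theorem stmt_14 {E : Type*} [NormedAddCommGroup E] [NormedSpace ℝ E]
    (f : E → ℝ) (f' : E → E →L[ℝ] ℝ) (hf : ∀ x, HasFDerivAt f (f' x) x)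
    (μ : ℝ → ℝ) (hμ0 : ∀ t ≥ (0:ℝ), 0 ≤ μ t)
    (hcurv : ∀ x y : E, ∀ α ∈ Set.Ioo (0:ℝ) 1,
      |α * f x + (1 - α) * f y - f (α • x + (1 - α) • y)| ≤ α * (1 - α) * μ ‖x - y‖)
    (hgrow : ∀ t ≥ (0:ℝ), ∀ β ∈ Set.Icc (0:ℝ) 1, β^2 * μ t ≤ μ (β * t))
    (hint : ∀ r > (0:ℝ), IntervalIntegrable (fun τ => μ τ / τ) MeasureTheory.volume 0 r)
    (ε r M : ℝ) (hε : 0 < ε) (hr : 0 < r)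
    (hσ : (∫ τ in (0:ℝ)..r, μ τ / τ) = ε / 2)
    (hM : 2 * ε / r^2 ≤ M) :
    ∀ x y : E, |f y - f x - f' x (y - x)| ≤ (1/2) * M * ‖y - x‖^2 + ε / 2 := by
  intro x y
  rcases eq_or_ne y x with rfl | hne
  · simp only [sub_self, map_zero, abs_zero, norm_zero]
    linarith
  have ht : 0 < ‖y - x‖ := norm_pos_iff.2 (sub_ne_zero.2 hne)
  have hfar := fun s hs0 hs ↦
    mul_abs_sub_sub_fderiv_le_of_curvature (s := s) (hf x) (hμ0 s hs0) hcurv ht hs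
  have hnear := abs_sub_sub_fderiv_le_of_curvature (hf x) (hμ0 _ ht.le) (hcurv y x)
  set t := ‖y - x‖
  set N := |f y - f x - f' x (y - x)|
  have hN0 : 0 ≤ N := abs_nonneg _
  have hMt : ε * (t / r) ^ 2 ≤ 1 / 2 * M * t ^ 2 := by
    calc ε * (t / r) ^ 2 = 1 / 2 * (2 * ε / r ^ 2) * t ^ 2 := by field_simp
      _ ≤ _ := by gcongr
  have hsmall : ∀ s ∈ Set.Icc 0 t, N / t ^ 2 * s ≤ μ s / s := by
    rintro s ⟨hs0, hst⟩
    rcases hs0.eq_or_lt with rfl | hs0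
    · simp
    have h := hgrow t ht.le (s / t) ⟨by positivity, (div_le_one ht).2 hst⟩
    rw [div_mul_cancel₀ _ ht.ne'] at h
    rw [le_div_iff₀ hs0]
    calc N / t ^ 2 * s * s = (s / t) ^ 2 * N := by field_simp
      _ ≤ (s / t) ^ 2 * μ t := by gcongr
      _ ≤ μ s := h
  have hlow : ∀ b, 0 < b → b ≤ t → N / t ^ 2 * (b ^ 2 / 2) ≤ ∫ τ in (0:ℝ)..b, μ τ / τ := by
    intro b hb hbt
    have h := intervalIntegral.integral_mono_on hb.le
      ((continuous_const.mul continuous_id).intervalIntegrable 0 b) (hint b hb)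
      (fun s hs ↦ hsmall s ⟨hs.1, hs.2.trans hbt⟩)
    have hval : ∫ τ in (0:ℝ)..b, N / t ^ 2 * τ = N / t ^ 2 * (b ^ 2 / 2) := by
      rw [intervalIntegral.integral_const_mul, integral_id]
      ring
    rwa [← hval]
  rcases le_or_gt r t with hrt | htr
  · have h := hlow r hr hrt
    rw [hσ] at h
    have hN : N ≤ ε * (t / r) ^ 2 := by
      calc N = N / t ^ 2 * (r ^ 2 / 2) * (2 * (t / r) ^ 2) := by field_simp
        _ ≤ ε / 2 * (2 * (t / r) ^ 2) := by gcongr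
        _ = ε * (t / r) ^ 2 := by ring
    linarith
  · have h₁ := hlow t ht le_rfl
    have hI : IntervalIntegrable (fun τ ↦ μ τ / τ) MeasureTheory.volume t r :=
      (hint t ht).symm.trans (hint r hr)
    have h₂ : (r - t) * (N / (2 * t)) ≤ ∫ τ in t..r, μ τ / τ := by
      have h := intervalIntegral.integral_mono_on_of_le_Ioo (f := fun _ ↦ N / (2 * t)) htr.le
        intervalIntegrable_const hI (fun s hs ↦ by
          have hs0 : 0 < s := ht.trans hs.1
          rw [div_le_div_iff₀ (by positivity) hs0]
          linarith [hfar s hs0.le hs.1])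
      rwa [intervalIntegral.integral_const, smul_eq_mul] at h
    have hsum := intervalIntegral.integral_add_adjacent_intervals (hint t ht) hI
    rw [hσ] at hsum
    have hlin : N * (r / t) ≤ ε := by
      have heq : N * (r / t) = 2 * (N / t ^ 2 * (t ^ 2 / 2) + (r - t) * (N / (2 * t))) := by
        field_simp
        ring
      linarith
    have hN : N ≤ ε * (t / r) := by
      calc N = N * (r / t) * (t / r) := by field_simp
        _ ≤ ε * (t / r) := by gcongr
    nlinarith [mul_nonneg hε.le (sq_nonneg (t / r - 1 / 2))]
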